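/- arXiv:2307.00971 — 4 statements merged into one kernel-verified Lean document; each statement's English description precedes it below -/
import Mathlib

section
/- The function f(ℓ) = (e − e^ℓ)/(e − e·ℓ) is monotonically increasing on the interval (0, 1), and for every ℓ ∈ (0, 1) it satisfies f(ℓ) ≥ 1 − 1/e. -/
open Real Set

theorem monotoneOn_exp_one_sub_exp_div :
    MonotoneOn (fun x : ℝ => (Real.exp 1 - Real.exp x) / (Real.exp 1 - Real.exp 1 * x))
      (Set.Iio 1) := by
  intro x hx y hy hxy
  have key : ∀ z : ℝ, (Real.exp 1 - Real.exp z) / (Real.exp 1 - Real.exp 1 * z) =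
      (Real.exp z - Real.exp 1) / (z - 1) / Real.exp 1 := by
    intro z
    rw [div_div, ← neg_div_neg_eq]
    congr 1 <;> ring
  have hx1 : x < 1 := hx
  have hy1 : y < 1 := hy
  simp only [key]
  gcongr ?_ / _
  exact convexOn_exp.secant_mono (mem_univ 1) (mem_univ x) (mem_univ y) hx1.ne hy1.ne hxy

/-- The function `f(ℓ) = (e - e^ℓ)/(e - e·ℓ)` is monotonically increasing on `(0,1)`,
and for every `ℓ ∈ (0,1)` it satisfies `f(ℓ) ≥ 1 - 1/e`. -/
theorem stmt_3 :
    MonotoneOn (fun ℓ : ℝ => (Real.exp 1 - Real.exp ℓ) / (Real.exp 1 - Real.exp 1 * ℓ))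
      (Set.Ioo 0 1) ∧
    ∀ ℓ ∈ Set.Ioo (0 : ℝ) 1,
      (Real.exp 1 - Real.exp ℓ) / (Real.exp 1 - Real.exp 1 * ℓ) ≥ 1 - 1 / Real.exp 1 := by
  refine ⟨monotoneOn_exp_one_sub_exp_div.mono fun x hx => hx.2, fun ℓ hℓ => ?_⟩
  have h := monotoneOn_exp_one_sub_exp_div (mem_Iio.2 one_pos) (mem_Iio.2 hℓ.2) hℓ.1.le
  have h0 : 1 - 1 / Real.exp 1 =
      (Real.exp 1 - Real.exp 0) / (Real.exp 1 - Real.exp 1 * 0) := by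
    rw [Real.exp_zero, mul_zero, sub_zero, sub_div, div_self (Real.exp_ne_zero 1)]
  rw [h0]
  exact h
end

section
/- Let 0 < c_2 < c_1 be real constants and define g(q) = (e^{−(c_1−q)}(1 − e^{−q}) + (1 − e^{−(c_1−q)})(1 − e^{−c_2}))/(1 − e^{−q}) for q ∈ [c_2, c_1]. Then for every q ∈ [c_2, c_1], g(q) ≥ e^{−c_1−c_2}·(e^{c_1}(e^{c_2} − 1) + 2·√((e^{c_1} − 1)(e^{c_2} − 1)) − e^{c_2} + 2), and this lower bound is attained at q = log(1 + √((e^{c_1} − 1)(e^{c_2} − 1))), which lies in [c_2, c_1]. -/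
open Real Set

/-- Completing the square in `y = x - 1`, with `a = e^{c₁}`, `b = e^{c₂}`, `x = e^q`. -/
lemma ratio_eq_add_sq {a b x s : ℝ} (ha : a ≠ 0) (hb : b ≠ 0) (hx : x ≠ 0)
    (hx1 : x - 1 ≠ 0) (hs : s ^ 2 = (a - 1) * (b - 1)) :
    (x / a * (1 - x⁻¹) + (1 - x / a) * (1 - b⁻¹)) / (1 - x⁻¹) =
      a⁻¹ * b⁻¹ * (a * (b - 1) + 2 * s - b + 2) + (x - 1 - s) ^ 2 / ((x - 1) * (a * b)) := by
  have h : 1 - x⁻¹ = (x - 1) / x := by field_simp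
  rw [h]
  field_simp
  linear_combination -hs

/-- Case-2 minimization for the two-threshold Top-1-of-2 algorithm: for
`0 < c₂ < c₁`, the function `g` is bounded below on `[c₂, c₁]` by the stated
constant, which is attained at `q = log (1 + √((e^{c₁}-1)(e^{c₂}-1))) ∈ [c₂, c₁]`. -/
theorem stmt_4 (c₁ c₂ : ℝ) (hc₂ : 0 < c₂) (hc : c₂ < c₁) :
    let g : ℝ → ℝ := fun q =>
      (Real.exp (-(c₁ - q)) * (1 - Real.exp (-q)) +
        (1 - Real.exp (-(c₁ - q))) * (1 - Real.exp (-c₂))) / (1 - Real.exp (-q))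
    let B : ℝ := Real.exp (-c₁ - c₂) *
      (Real.exp c₁ * (Real.exp c₂ - 1) +
        2 * Real.sqrt ((Real.exp c₁ - 1) * (Real.exp c₂ - 1)) - Real.exp c₂ + 2)
    let qm : ℝ := Real.log (1 + Real.sqrt ((Real.exp c₁ - 1) * (Real.exp c₂ - 1)))
    (∀ q ∈ Set.Icc c₂ c₁, g q ≥ B) ∧ qm ∈ Set.Icc c₂ c₁ ∧ g qm = B := by
  intro g B qm
  have hb : 1 < exp c₂ := one_lt_exp_iff.2 hc₂
  have hab : exp c₂ < exp c₁ := exp_lt_exp.2 hc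
  have hpos : 0 < (exp c₁ - 1) * (exp c₂ - 1) := mul_pos (by linarith) (by linarith)
  have hs : √((exp c₁ - 1) * (exp c₂ - 1)) ^ 2 = (exp c₁ - 1) * (exp c₂ - 1) :=
    sq_sqrt hpos.le
  have hs0 : 0 < √((exp c₁ - 1) * (exp c₂ - 1)) := sqrt_pos.2 hpos
  have key : ∀ q, 0 < q → g q = B + (exp q - 1 - √((exp c₁ - 1) * (exp c₂ - 1))) ^ 2 /
      ((exp q - 1) * (exp c₁ * exp c₂)) := by
    intro q hq
    have hq1 : exp q - 1 ≠ 0 := (sub_pos.2 (one_lt_exp_iff.2 hq)).ne'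
    have h := ratio_eq_add_sq (exp_ne_zero c₁) (exp_ne_zero c₂) (exp_ne_zero q) hq1 hs
    have e₁ : exp (-(c₁ - q)) = exp q / exp c₁ := by rw [neg_sub, exp_sub]
    have e₂ : exp (-c₁ - c₂) = (exp c₁)⁻¹ * (exp c₂)⁻¹ := by
      rw [sub_eq_add_neg, exp_add, exp_neg, exp_neg]
    simp only [g, B, e₁, e₂]
    rwa [exp_neg q, exp_neg c₂]
  have hqm : exp qm = 1 + √((exp c₁ - 1) * (exp c₂ - 1)) := exp_log (by linarith)
  have hmem : qm ∈ Set.Icc c₂ c₁ := by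
    constructor <;> rw [← exp_le_exp, hqm]
    · have : exp c₂ - 1 ≤ √((exp c₁ - 1) * (exp c₂ - 1)) := le_sqrt_of_sq_le (by nlinarith)
      linarith
    · have : √((exp c₁ - 1) * (exp c₂ - 1)) ≤ exp c₁ - 1 :=
        sqrt_le_iff.2 ⟨by linarith, by nlinarith⟩
      linarith
  refine ⟨fun q hq => ?_, hmem, ?_⟩
  · have hq0 : 0 < q := hc₂.trans_le hq.1
    have hq1 : 0 < exp q - 1 := sub_pos.2 (one_lt_exp_iff.2 hq0)
    rw [key q hq0, ge_iff_le, le_add_iff_nonneg_right]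
    positivity
  · rw [key qm (hc₂.trans_le hmem.1), hqm]
    simp
end

section
/- Let k ≥ 1 and n ≥ 1 be integers with n ≤ e^{√k}. Then the probability that a uniformly random permutation of {1, …, n} has at least k left-to-right maxima is at most k^{−k/5}. -/
open Real Finset

/-- The number of left-to-right maxima of a permutation. -/
def recordCount {n : ℕ} (σ : Equiv.Perm (Fin n)) : ℕ :=
  (Finset.univ.filter fun j : Fin n => ∀ i, i < j → σ i < σ j).card

/-- The number of permutations of `Fin n` with at least `k` records, defined by recursion. -/
def recordTail : ℕ → ℕ → ℕ
  | n, 0 => n.factorial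
  | 0, _ + 1 => 0
  | n + 1, k + 1 => recordTail n k + n * recordTail n (k + 1)

/-- The permutation of `Fin (n + 1)` with last value `p` whose other values are ordered as in `τ`. -/
def appendLast {n : ℕ} (p : Fin (n + 1)) (τ : Equiv.Perm (Fin n)) : Equiv.Perm (Fin (n + 1)) :=
  (finSuccEquiv' (Fin.last n)).trans ((Equiv.optionCongr τ).trans (finSuccEquiv' p).symm)

lemma appendLast_last {n : ℕ} (p : Fin (n + 1)) (τ : Equiv.Perm (Fin n)) :
    appendLast p τ (Fin.last n) = p := by
  simp [appendLast]

lemma appendLast_castSucc {n : ℕ} (p : Fin (n + 1)) (τ : Equiv.Perm (Fin n)) (i : Fin n) :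
    appendLast p τ i.castSucc = p.succAbove (τ i) := by
  have h : finSuccEquiv' (Fin.last n) i.castSucc = some i := by
    rw [← Fin.succAbove_last_apply, finSuccEquiv'_succAbove]
  simp [appendLast, h]

lemma appendLast_bijective (n : ℕ) :
    Function.Bijective fun x : Fin (n + 1) × Equiv.Perm (Fin n) => appendLast x.1 x.2 := by
  rw [Fintype.bijective_iff_injective_and_card]
  constructor
  · rintro ⟨p, τ⟩ ⟨q, ρ⟩ h
    simp only at h
    have hp : p = q := by rw [← appendLast_last p τ, h, appendLast_last]
    subst hp
    have : τ = ρ := by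
      ext i : 1
      have hi := appendLast_castSucc p τ i
      rw [h, appendLast_castSucc] at hi
      exact (Fin.succAbove_right_injective hi).symm
    rw [this]
  · simp [Fintype.card_perm, Nat.factorial_succ]

lemma recordCount_appendLast {n : ℕ} (p : Fin (n + 1)) (τ : Equiv.Perm (Fin n)) :
    recordCount (appendLast p τ) = recordCount τ + if p = Fin.last n then 1 else 0 := by
  unfold recordCount
  rw [Finset.card_filter, Finset.card_filter, Fin.sum_univ_castSucc]
  congr 1
  · refine Finset.sum_congr rfl fun j _ => ?_
    congr 1
    rw [eq_iff_iff, Fin.forall_fin_succ']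
    simp [appendLast_castSucc, Fin.le_last, Fin.succAbove_lt_succAbove_iff]
  · congr 1
    rw [eq_iff_iff, Fin.forall_fin_succ']
    simp only [appendLast_castSucc, appendLast_last, Fin.castSucc_lt_last, lt_irrefl,
      forall_true_left, IsEmpty.forall_iff, and_true]
    constructor
    · intro h
      by_contra hp
      obtain ⟨q, rfl⟩ := Fin.exists_castSucc_eq.2 hp
      have hq := h (τ.symm q)
      simp only [Equiv.apply_symm_apply, Fin.succAbove_castSucc_self] at hq
      exact absurd hq Fin.castSucc_lt_succ.not_gt
    · rintro rfl i
      simp [Fin.castSucc_lt_last]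

theorem card_le_recordCount (n k : ℕ) :
    (Finset.univ.filter fun σ : Equiv.Perm (Fin n) => k ≤ recordCount σ).card
      = recordTail n k := by
  induction n generalizing k with
  | zero =>
    cases k with
    | zero => simp [recordTail]
    | succ k => simp [recordTail, recordCount]
  | succ n ih =>
    cases k with
    | zero => simp [recordTail, Fintype.card_perm]
    | succ k =>
      rw [Finset.card_filter, ← (appendLast_bijective n).sum_comp, Fintype.sum_prod_type,
        Fin.sum_univ_castSucc]
      simp only [recordCount_appendLast, if_true, (Fin.castSucc_lt_last _).ne, if_false,
        add_zero, add_le_add_iff_right, ← Finset.card_filter, ih]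
      simp [recordTail, add_comm]

lemma recordTail_mul_pow_le (m n k : ℕ) :
    recordTail n k * (m + 1) ^ k ≤ (m + 1).ascFactorial n := by
  induction n generalizing k with
  | zero => cases k <;> simp [recordTail]
  | succ n ih =>
    cases k with
    | zero =>
      rw [recordTail, pow_zero, mul_one, Nat.ascFactorial_eq_factorial_mul_choose]
      exact Nat.le_mul_of_pos_right _ (Nat.choose_pos (by omega))
    | succ k =>
      rw [recordTail, Nat.ascFactorial_succ]
      have h₁ := Nat.mul_le_mul_left (m + 1) (ih k)
      have h₂ := Nat.mul_le_mul_left n (ih (k + 1))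
      calc _ = (m + 1) * (recordTail n k * (m + 1) ^ k)
            + n * (recordTail n (k + 1) * (m + 1) ^ (k + 1)) := by ring
        _ ≤ _ := (add_le_add h₁ h₂).trans_eq (by ring)

/-- The Chernoff bound for the number of records. -/
lemma recordTail_mul_pow_le_factorial_mul_choose (m n k : ℕ) :
    recordTail n k * (m + 1) ^ k ≤ n.factorial * (n + m).choose m := by
  have h := recordTail_mul_pow_le m n k
  rwa [Nat.ascFactorial_eq_factorial_mul_choose, add_comm m n, Nat.choose_symm_add] at h

lemma choose_add_le_pow {n m : ℕ} (hn : 4 ≤ n) (hm : 2 ≤ m) : (n + m).choose m ≤ n ^ m := by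
  induction m, hm using Nat.le_induction with
  | base =>
    rw [Nat.choose_two_right]
    apply Nat.div_le_of_le_mul
    obtain ⟨d, rfl⟩ := Nat.exists_eq_add_of_le hn
    rw [show 4 + d + 2 - 1 = 4 + d + 1 by omega]
    nlinarith
  | succ m hm ih =>
    have h := Nat.add_one_mul_choose_eq (n + m) m
    refine Nat.le_of_mul_le_mul_right (c := m + 1) ?_ (by omega)
    rw [← add_assoc, ← h, pow_succ, mul_comm, mul_assoc]
    exact Nat.mul_le_mul ih (by nlinarith)

lemma div_le_rpow_of_pow_mul_le {a b k : ℕ} (hk : 1 ≤ k) (hb : 0 < b)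
    (h : a ^ 5 * k ^ k ≤ b ^ 5) : (a : ℝ) / b ≤ (k : ℝ) ^ (-(k : ℝ) / 5) := by
  have hk₀ : (0 : ℝ) < k := by exact_mod_cast hk
  have hb₀ : (0 : ℝ) < b := by exact_mod_cast hb
  refine le_of_pow_le_pow_left₀ (n := 5) (by norm_num) (by positivity) ?_
  have h₁ : ((k : ℝ) ^ (-(k : ℝ) / 5)) ^ 5 = ((k : ℝ) ^ k)⁻¹ := by
    rw [← Real.rpow_natCast, ← Real.rpow_mul hk₀.le, ← Real.rpow_natCast, ← Real.rpow_neg hk₀.le]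
    congr 1
    push_cast
    ring
  rw [h₁, div_pow, div_le_iff₀ (by positivity), ← div_eq_inv_mul, le_div_iff₀ (by positivity)]
  exact_mod_cast h

lemma div_le_rpow_of_choose {n m k N : ℕ} (hk : 1 ≤ k) (hn : n ≤ N)
    (h : (N + m).choose m ^ 5 * k ^ k ≤ ((m + 1) ^ k) ^ 5) :
    (recordTail n k : ℝ) / n.factorial ≤ (k : ℝ) ^ (-(k : ℝ) / 5) := by
  refine div_le_rpow_of_pow_mul_le hk n.factorial_pos ?_
  have h₁ : recordTail n k * (m + 1) ^ k ≤ n.factorial * (N + m).choose m :=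
    (recordTail_mul_pow_le_factorial_mul_choose m n k).trans
      (Nat.mul_le_mul_left _ (Nat.choose_le_choose _ (by omega)))
  refine Nat.le_of_mul_le_mul_right (c := ((m + 1) ^ k) ^ 5) ?_ (by positivity)
  calc recordTail n k ^ 5 * k ^ k * ((m + 1) ^ k) ^ 5
      = (recordTail n k * (m + 1) ^ k) ^ 5 * k ^ k := by ring
    _ ≤ (n.factorial * (N + m).choose m) ^ 5 * k ^ k := by gcongr
    _ = n.factorial ^ 5 * ((N + m).choose m ^ 5 * k ^ k) := by ring
    _ ≤ _ := by gcongr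

lemma div_le_rpow_of_log {n m k : ℕ} (hk : 4 ≤ k) (hm : 2 ≤ m)
    (hne : (n : ℝ) ≤ Real.exp (√k))
    (h : m + √k * (2 / 5 * Real.log √k) ≤ √k * Real.log (m + 1)) :
    (recordTail n k : ℝ) / n.factorial ≤ (k : ℝ) ^ (-(k : ℝ) / 5) := by
  have hk₀ : (0 : ℝ) < k := by exact_mod_cast (by omega : 0 < k)
  have hs : √(k : ℝ) * √k = k := Real.mul_self_sqrt hk₀.le
  have hs₂ : 2 ≤ √(k : ℝ) := Real.le_sqrt_of_sq_le (by norm_num; exact_mod_cast hk)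
  have h₄ : ((max n 4 : ℕ) : ℝ) ≤ Real.exp √k := by
    rw [Nat.cast_max]
    refine max_le hne ?_
    calc ((4 : ℕ) : ℝ) ≤ Real.exp 1 * Real.exp 1 := by
          have := Real.exp_one_gt_d9
          push_cast
          nlinarith
      _ = Real.exp 2 := by rw [← Real.exp_add]; norm_num
      _ ≤ _ := Real.exp_le_exp.2 hs₂
  have h₅ : recordTail n k * (m + 1) ^ k ≤ n.factorial * max n 4 ^ m :=
    (recordTail_mul_pow_le_factorial_mul_choose m n k).trans <| Nat.mul_le_mul_left _ <|
      (Nat.choose_le_choose m (by omega : n + m ≤ max n 4 + m)).trans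
        (choose_add_le_pow (le_max_right _ _) hm)
  have h₆ : (recordTail n k : ℝ) * (m + 1) ^ k ≤ n.factorial * ((max n 4 : ℕ) : ℝ) ^ m := by
    exact_mod_cast h₅
  have hf : (0 : ℝ) < n.factorial := by exact_mod_cast n.factorial_pos
  have hm₀ : (0 : ℝ) < m + 1 := by positivity
  have hlog : Real.log k = 2 * Real.log √k := by
    conv_lhs => rw [← hs, Real.log_mul (by positivity) (by positivity)]
    ring
  rw [div_le_iff₀ hf]
  refine le_of_mul_le_mul_right (a := ((m : ℝ) + 1) ^ k) ?_ (by positivity)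
  calc _ ≤ (n.factorial : ℝ) * ((max n 4 : ℕ) : ℝ) ^ m := h₆
    _ ≤ n.factorial * Real.exp √k ^ m := by gcongr
    _ ≤ n.factorial * ((k : ℝ) ^ (-(k : ℝ) / 5) * (m + 1) ^ k) := by
      gcongr
      rw [← Real.exp_nat_mul, Real.rpow_def_of_pos hk₀, ← Real.exp_log (pow_pos hm₀ k),
        ← Real.exp_add, Real.exp_le_exp, Real.log_pow, hlog]
      have := mul_le_mul_of_nonneg_left h (Real.sqrt_nonneg (k : ℝ))
      rw [mul_add, ← mul_assoc, ← mul_assoc, ← mul_assoc √(k : ℝ) √k, hs] at this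
      linarith
    _ = _ := by ring

lemma log_three_gt : 1.097 < Real.log 3 := by
  have h : Real.log (2 ^ 19) ≤ Real.log (3 ^ 12) := Real.log_le_log (by norm_num) (by norm_num)
  rw [Real.log_pow, Real.log_pow] at h
  push_cast at h
  linarith [Real.log_two_gt_d9]

lemma two_add_le_mul_log_three {s : ℝ} (h₁ : 4 ≤ s) (h₂ : s ≤ 8) :
    2 + s * (2 / 5 * Real.log s) ≤ s * Real.log 3 := by
  have key (a : ℝ) (ha : 0 < a) : Real.log s ≤ Real.log a + (s / a - 1) := by
    have := Real.log_le_sub_one_of_pos (div_pos (by linarith : 0 < s) ha)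
    rw [Real.log_div (by linarith) ha.ne'] at this
    linarith
  have l3 := log_three_gt
  have l2 := Real.log_two_lt_d9
  suffices h : ∃ u, Real.log s ≤ u ∧ 2 + s * (2 / 5 * u) ≤ s * 1.097 by
    obtain ⟨u, hu, h⟩ := h
    nlinarith [mul_le_mul_of_nonneg_left hu (by linarith : 0 ≤ s)]
  rcases le_total s 6 with h | h
  · refine ⟨2 * 0.6931471808 + (s / 4 - 1), ?_, by nlinarith⟩
    have h4 : Real.log 4 = 2 * Real.log 2 := by
      rw [show (4 : ℝ) = 2 ^ 2 by norm_num, Real.log_pow]; norm_num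
    linarith [key 4 (by norm_num)]
  · refine ⟨3 * 0.6931471808 + (s / 8 - 1), ?_, by nlinarith⟩
    have h8 : Real.log 8 = 3 * Real.log 2 := by
      rw [show (8 : ℝ) = 2 ^ 3 by norm_num, Real.log_pow]; norm_num
    linarith [key 8 (by norm_num)]

lemma floor_half_add_le_mul_log {s : ℝ} (h : 8 ≤ s) :
    (⌊s / 2⌋₊ : ℝ) + s * (2 / 5 * Real.log s) ≤ s * Real.log (⌊s / 2⌋₊ + 1) := by
  have h₁ : (⌊s / 2⌋₊ : ℝ) ≤ s / 2 := Nat.floor_le (by linarith)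
  have h₂ : Real.log (s / 2) ≤ Real.log (⌊s / 2⌋₊ + 1) :=
    Real.log_le_log (by linarith) (Nat.lt_floor_add_one _).le
  rw [Real.log_div (by linarith) (by norm_num)] at h₂
  have h₃ : 3 * Real.log 2 ≤ Real.log s := by
    have : Real.log (2 ^ 3) ≤ Real.log s := Real.log_le_log (by norm_num) (by linarith)
    rw [Real.log_pow] at this
    exact_mod_cast this
  have l2 := Real.log_two_gt_d9
  have h₄ : 1 / 2 + 2 / 5 * Real.log s ≤ Real.log (⌊s / 2⌋₊ + 1) := by linarith
  have := mul_le_mul_of_nonneg_left h₄ (by linarith : 0 ≤ s)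
  linarith

/-- A bound on `n ≤ exp √k` from a rational upper bound `a / b` on `√k`. -/
lemma le_of_le_exp_sqrt {n k : ℕ} (N a b : ℕ) (hne : (n : ℝ) ≤ Real.exp √k)
    (hab : k * b ^ 2 ≤ a ^ 2) (hN : 2719 ^ a < 1000 ^ a * (N + 1) ^ b) : n ≤ N := by
  by_contra! hlt
  have h₁ : (b : ℝ) * √k ≤ a := by
    refine abs_le_of_sq_le_sq' ?_ (by positivity) |>.2
    rw [mul_pow, Real.sq_sqrt (by positivity), mul_comm]
    exact_mod_cast hab
  have h₂ : ((N : ℝ) + 1) ^ b ≤ 2.719 ^ a :=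
    calc ((N : ℝ) + 1) ^ b ≤ (Real.exp √k) ^ b := by
          gcongr
          exact le_trans (by exact_mod_cast hlt) hne
      _ = Real.exp (b * √k) := (Real.exp_nat_mul _ _).symm
      _ ≤ Real.exp (a * 1) := by rw [mul_one]; exact Real.exp_le_exp.2 h₁
      _ = Real.exp 1 ^ a := Real.exp_nat_mul _ _
      _ ≤ 2.719 ^ a := by
          gcongr
          linarith [Real.exp_one_lt_d9]
  rw [show (2.719 : ℝ) = 2719 / 1000 by norm_num, div_pow, le_div_iff₀ (by positivity)] at h₂
  have h₃ : (N + 1) ^ b * 1000 ^ a ≤ 2719 ^ a := by exact_mod_cast h₂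
  linarith

lemma recordTail_div_le_of_lt_six {n k : ℕ} (hk : 1 ≤ k) (hk₆ : k < 6)
    (hne : (n : ℝ) ≤ Real.exp √k) :
    (recordTail n k : ℝ) / n.factorial ≤ (k : ℝ) ^ (-(k : ℝ) / 5) := by
  refine div_le_rpow_of_pow_mul_le hk n.factorial_pos ?_
  interval_cases k
  · have h := recordTail_mul_pow_le_factorial_mul_choose 0 n 1
    simp only [zero_add, one_pow, mul_one, Nat.choose_zero_right] at h ⊢
    gcongr
  · have h := le_of_le_exp_sqrt 4 3 2 hne (by norm_num) (by norm_num)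
    interval_cases n <;> decide +kernel
  · have h := le_of_le_exp_sqrt 5 35 20 hne (by norm_num) (by norm_num)
    interval_cases n <;> decide +kernel
  · have h := le_of_le_exp_sqrt 7 2 1 hne (by norm_num) (by norm_num)
    interval_cases n <;> decide +kernel
  · have h := le_of_le_exp_sqrt 9 9 4 hne (by norm_num) (by norm_num)
    interval_cases n <;> decide +kernel

lemma recordTail_div_le_of_lt_sixteen {n k : ℕ} (hk₆ : 6 ≤ k) (hk : k < 16)
    (hne : (n : ℝ) ≤ Real.exp √k) :
    (recordTail n k : ℝ) / n.factorial ≤ (k : ℝ) ^ (-(k : ℝ) / 5) := by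
  have main (N a b : ℕ) (hab : k * b ^ 2 ≤ a ^ 2) (hN : 2719 ^ a < 1000 ^ a * (N + 1) ^ b)
      (h : (N + 2).choose 2 ^ 5 * k ^ k ≤ ((2 + 1) ^ k) ^ 5) :=
    div_le_rpow_of_choose (by omega) (le_of_le_exp_sqrt N a b hne hab hN) h
  interval_cases k
  · exact main 11 123 50 (by norm_num) (by norm_num) (by decide +kernel)
  · exact main 14 133 50 (by norm_num) (by norm_num) (by decide +kernel)
  · exact main 17 142 50 (by norm_num) (by norm_num) (by decide +kernel)
  · exact main 20 3 1 (by norm_num) (by norm_num) (by decide +kernel)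
  · exact main 24 159 50 (by norm_num) (by norm_num) (by decide +kernel)
  · exact main 28 166 50 (by norm_num) (by norm_num) (by decide +kernel)
  · exact main 32 174 50 (by norm_num) (by norm_num) (by decide +kernel)
  · exact main 37 181 50 (by norm_num) (by norm_num) (by decide +kernel)
  · exact main 43 188 50 (by norm_num) (by norm_num) (by decide +kernel)
  · exact main 49 194 50 (by norm_num) (by norm_num) (by decide +kernel)

theorem recordTail_div_factorial_le {n k : ℕ} (hk : 1 ≤ k) (hne : (n : ℝ) ≤ Real.exp √k) :
    (recordTail n k : ℝ) / n.factorial ≤ (k : ℝ) ^ (-(k : ℝ) / 5) := by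
  rcases lt_or_ge k 6 with h₆ | h₆
  · exact recordTail_div_le_of_lt_six hk h₆ hne
  rcases lt_or_ge k 16 with h₁₆ | h₁₆
  · exact recordTail_div_le_of_lt_sixteen h₆ h₁₆ hne
  rcases lt_or_ge k 64 with h₆₄ | h₆₄
  · refine div_le_rpow_of_log (m := 2) (by omega) le_rfl hne ?_
    have hlo : 4 ≤ √(k : ℝ) := Real.le_sqrt_of_sq_le (by norm_num; exact_mod_cast h₁₆)
    have hhi : √(k : ℝ) ≤ 8 := Real.sqrt_le_iff.2 ⟨by norm_num, by norm_num; exact_mod_cast h₆₄.le⟩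
    have := two_add_le_mul_log_three hlo hhi
    norm_num at this ⊢
    exact this
  · have hlo : 8 ≤ √(k : ℝ) := Real.le_sqrt_of_sq_le (by norm_num; exact_mod_cast h₆₄)
    exact div_le_rpow_of_log (by omega) (Nat.le_floor (by push_cast; linarith)) hne
      (floor_half_add_le_mul_log hlo)

/-- If `n ≤ e^{√k}`, the probability that a uniformly random permutation of
`{1, …, n}` has at least `k` left-to-right maxima is at most `k^{-k/5}`. -/
theorem stmt_13 (k n : ℕ) (hk : 1 ≤ k) (hn : 1 ≤ n)
    (hne : (n : ℝ) ≤ Real.exp (Real.sqrt k)) :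
    ((Finset.univ.filter fun σ : Equiv.Perm (Fin n) =>
        k ≤ (Finset.univ.filter fun j : Fin n => ∀ i, i < j → σ i < σ j).card).card : ℝ)
      / (Fintype.card (Equiv.Perm (Fin n)) : ℝ)
      ≤ (k : ℝ) ^ (-(k : ℝ) / 5) := by
  rw [Fintype.card_perm, Fintype.card_fin]
  have h := recordTail_div_factorial_le hk hne
  rw [← card_le_recordCount] at h
  exact h
end

section
/- Let c_1 = 1.51921, c_2 = 0.380251, c_3 = 0.0386845. Then for every real ℓ with 0 < ℓ ≤ c_1, one has e^{ℓ}·( −e^{−c_1}·(ℓ+1) + e^{−c_2} + e^{−c_1+c_2−c_3} + e^{−c_1}·c_3 ) ≥ e^{−c_1}·c_3 − e^{−c_1} + e^{−c_2} + e^{−c_1+c_2−c_3}. -/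
open Real

/-- For `c₁ = 1.51921`, `c₂ = 0.380251`, `c₃ = 0.0386845`, the function
`C₄(ℓ) = e^ℓ (-e^{-c₁}(ℓ+1) + e^{-c₂} + e^{-c₁+c₂-c₃} + e^{-c₁} c₃)` on `(0, c₁]`
is bounded below by its limit as `ℓ → 0`, namely
`e^{-c₁} c₃ - e^{-c₁} + e^{-c₂} + e^{-c₁+c₂-c₃}`. -/
theorem stmt_19 :
    let c₁ : ℝ := 1.51921
    let c₂ : ℝ := 0.380251
    let c₃ : ℝ := 0.0386845
    ∀ ℓ : ℝ, 0 < ℓ → ℓ ≤ c₁ →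
      Real.exp ℓ * (-Real.exp (-c₁) * (ℓ + 1) + Real.exp (-c₂) +
          Real.exp (-c₁ + c₂ - c₃) + Real.exp (-c₁) * c₃)
        ≥ Real.exp (-c₁) * c₃ - Real.exp (-c₁) + Real.exp (-c₂) +
            Real.exp (-c₁ + c₂ - c₃) := by
  intro c₁ c₂ c₃ ℓ h_pos hle
  have exp_lower (x y : ℝ) : exp x * (1 + (y - x)) ≤ exp y := by
    calc exp x * (1 + (y - x)) ≤ exp x * exp (y - x) := by
          gcongr
          linarith [add_one_le_exp (y - x)]
      _ = exp y := by rw [← exp_add]; congr 1; ring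
  have h₂ := exp_lower (-c₁) (-c₂)
  have h₃ := exp_lower (-c₁) (-c₁ + c₂ - c₃)
  have ha := exp_pos (-c₁)
  have hℓ := add_one_le_exp ℓ
  generalize exp (-c₁) = a at *
  generalize exp (-c₂) = b at *
  generalize exp (-c₁ + c₂ - c₃) = d at *
  generalize exp ℓ = e at *
  have hK : 0 ≤ b + d + a * c₃ - a * (2 + ℓ) := by
    nlinarith [mul_nonneg ha.le (sub_nonneg.2 hle)]
  have h_gain := mul_nonneg (show 0 ≤ e - 1 by linarith) hK
  have h_exp := mul_nonneg ha.le (show 0 ≤ e - 1 - ℓ by linarith)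
  linear_combination h_gain + h_exp
end
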